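/- arXiv:1404.1042 — 3 statements merged into one kernel-verified Lean document; each statement's English description precedes it below -/
import Mathlib

section
/- The following weight-12 double-zeta identity holds: 36·Ze^{12} + 84·Ze^{10,2} − 112·Ze^{9,3} − 168·Ze^{3,9} + 56·Ze^{8,4} + 28·Ze^{4,8} − 104·Ze^{7,5} − 112·Ze^{5,7} + (100/3)·Ze^{6,6} = 0. (It expresses the vanishing of the coefficient of the monotangent Te^{1} in the reduction of the alternal multitangent Tan^{2,7,4}.) -/
/-- `Ze^a = ∑_{n ≥ 1} n^{-a}`. -/
noncomputable def Ze1 (a : ℕ) : ℝ :=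
  ∑' n : {n : ℕ // 1 ≤ n}, ((n : ℕ) : ℝ) ^ (-(a : ℤ))

/-- `Ze^{a,b} = ∑_{m > n ≥ 1} m^{-a} n^{-b}`. -/
noncomputable def Ze2 (a b : ℕ) : ℝ :=
  ∑' p : {p : ℕ × ℕ // 1 ≤ p.2 ∧ p.2 < p.1},
    ((p.1.1 : ℕ) : ℝ) ^ (-(a : ℤ)) * ((p.1.2 : ℕ) : ℝ) ^ (-(b : ℤ))

/-- summand of the product of two zetas -/
noncomputable def FF (a b : ℕ) (x : ℕ × ℕ) : ℝ := (x.1 : ℝ) ^ (-(a : ℤ)) * (x.2 : ℝ) ^ (-(b : ℤ))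

def SS : Set (ℕ × ℕ) := {p | 1 ≤ p.2 ∧ p.2 < p.1}

/-- shifted summand of the double zeta -/
noncomputable def KK (r s : ℕ) (x : ℕ × ℕ) : ℝ := SS.indicator (FF r s) (x.1 + x.2, x.2)

theorem FF_summable (a b : ℕ) (ha : 2 ≤ a) (hb : 2 ≤ b) : Summable (FF a b) := by
  have h : ∀ c : ℕ, 2 ≤ c → Summable (fun n : ℕ => (n : ℝ) ^ (-(c : ℤ))) := by
    intro c hc
    have := (Real.summable_nat_pow_inv (p := c)).2 (by omega)
    simpa [zpow_neg] using this
  exact (h a ha).mul_of_nonneg (h b hb) (fun n => by positivity) (fun n => by positivity)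

theorem KK_eq (r s p q : ℕ) :
    KK r s (p, q) = if 1 ≤ p ∧ 1 ≤ q then ((p : ℝ) + q)⁻¹ ^ r * ((q : ℝ))⁻¹ ^ s else 0 := by
  unfold KK FF SS
  rw [Set.indicator_apply]
  have : (((p, q).1 + (p, q).2, (p, q).2) ∈ {p : ℕ × ℕ | 1 ≤ p.2 ∧ p.2 < p.1}) ↔ 1 ≤ p ∧ 1 ≤ q := by
    simp only [Set.mem_ofPred_eq]; omega
  simp only [this]
  split_ifs <;> simp [zpow_neg]

theorem KK_summable (k : ℕ) (hk : k < 10) : Summable (KK (k + 2) (10 - k)) := by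
  refine Summable.of_nonneg_of_le ?_ ?_ (FF_summable 2 10 le_rfl (by norm_num))
  · rintro ⟨p, q⟩
    rw [KK_eq]; split_ifs <;> positivity
  · rintro ⟨p, q⟩
    rw [KK_eq]
    split_ifs with h
    · have hp : (1 : ℝ) ≤ p := by exact_mod_cast h.1
      have hq : (1 : ℝ) ≤ q := by exact_mod_cast h.2
      have h1 : ((p : ℝ) + q)⁻¹ ≤ (p : ℝ)⁻¹ := inv_anti₀ (by linarith) (by linarith)
      have h2 : ((p : ℝ) + q)⁻¹ ≤ (q : ℝ)⁻¹ := inv_anti₀ (by linarith) (by linarith)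
      have h0 : 0 ≤ ((p : ℝ) + q)⁻¹ := by positivity
      calc ((p : ℝ) + q)⁻¹ ^ (k + 2) * ((q : ℝ))⁻¹ ^ (10 - k)
          = ((p : ℝ) + q)⁻¹ ^ 2 * ((p : ℝ) + q)⁻¹ ^ k * ((q : ℝ))⁻¹ ^ (10 - k) := by
            rw [pow_add]; ring
        _ ≤ (p : ℝ)⁻¹ ^ 2 * (q : ℝ)⁻¹ ^ k * ((q : ℝ))⁻¹ ^ (10 - k) := by gcongr
        _ = (p : ℝ)⁻¹ ^ 2 * (q : ℝ)⁻¹ ^ 10 := by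
            rw [mul_assoc, ← pow_add]; congr 2; omega
        _ = FF 2 10 (p, q) := by
            simp only [FF, zpow_neg, zpow_natCast, inv_pow]
    · unfold FF; positivity

theorem Ze2_ind (a b : ℕ) : Ze2 a b = ∑' x, SS.indicator (FF a b) x := by
  rw [← tsum_subtype]; rfl

theorem Ze2_KK (a b : ℕ) : Ze2 a b = ∑' x, KK a b x := by
  rw [Ze2_ind]
  symm
  have hg : Function.Injective (fun x : ℕ × ℕ => (x.1 + x.2, x.2)) := by
    rintro ⟨a, b⟩ ⟨c, d⟩ h
    simp only [Prod.mk.injEq] at h ⊢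
    omega
  refine hg.tsum_eq (f := SS.indicator (FF a b)) ?_
  rintro ⟨p, q⟩ h
  have h' : (p, q) ∈ SS := by
    by_contra hc
    exact h (Set.indicator_of_notMem hc _)
  have h2 : 1 ≤ q ∧ q < p := h'
  exact ⟨(p - q, q), Prod.ext (Nat.sub_add_cancel h2.2.le) rfl⟩

theorem Ze1_diag (a b : ℕ) (ha : 1 ≤ a) :
    Ze1 (a + b) = ∑' x, ({x | x.1 = x.2} : Set (ℕ × ℕ)).indicator (FF a b) x := by
  have hg : Function.Injective (fun n : {n : ℕ // 1 ≤ n} => ((n : ℕ), (n : ℕ))) := by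
    intro m n h
    simp only [Prod.mk.injEq] at h
    exact Subtype.ext h.1
  rw [← hg.tsum_eq]
  · unfold Ze1
    refine tsum_congr fun n => ?_
    rw [Set.indicator_of_mem (by simp)]
    simp only [FF, zpow_neg, zpow_natCast]
    rw [pow_add, mul_inv]
  · rintro ⟨p, q⟩ h
    have h' : (p, q) ∈ ({x | x.1 = x.2} : Set (ℕ × ℕ)) := by
      by_contra hc
      exact h (Set.indicator_of_notMem hc _)
    have h2 : p = q := h'
    subst h2
    refine ⟨⟨p, ?_⟩, rfl⟩
    by_contra hc
    have : p = 0 := by omega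
    subst this
    apply h
    rw [Set.indicator_of_mem h']
    have : a ≠ 0 := by omega
    simp [FF, this]

theorem FF_swap (a b : ℕ) (x : ℕ × ℕ) : FF a b x.swap = FF b a x := by
  simp [FF, mul_comm]

theorem stuffle (a b : ℕ) (ha : 2 ≤ a) (hb : 2 ≤ b) :
    ∑' x, FF a b x = Ze2 a b + Ze2 b a + Ze1 (a + b) := by
  have hs := FF_summable a b ha hb
  have hs' := FF_summable b a hb ha
  have e1 : Ze2 b a = ∑' x : ℕ × ℕ, SS.indicator (FF b a) x.swap := by
    rw [Ze2_ind]
    exact ((Equiv.prodComm ℕ ℕ).tsum_eq _).symm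
  have s2 : Summable (fun x : ℕ × ℕ => SS.indicator (FF b a) x.swap) :=
    (Equiv.prodComm ℕ ℕ).summable_iff.2 (hs'.indicator SS)
  rw [Ze1_diag a b (by omega), e1, Ze2_ind, ← (hs.indicator _).tsum_add s2,
    ← ((hs.indicator _).add s2).tsum_add (hs.indicator _)]
  refine tsum_congr ?_
  rintro ⟨p, q⟩
  simp only [Set.indicator_apply, FF_swap, SS, Set.mem_ofPred_eq, Prod.swap]
  have ha0 : a ≠ 0 := by omega
  have hb0 : b ≠ 0 := by omega
  rcases lt_trichotomy p q with h | h | h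
  · rcases Nat.eq_zero_or_pos p with h0 | h0
    · subst h0; simp [FF, ha0, h.ne]
    · have : 1 ≤ p := h0
      simp [h, this, h.ne, h.le, h.not_gt, FF, mul_comm]
  · subst h; simp
  · rcases Nat.eq_zero_or_pos q with h0 | h0
    · subst h0; simp [FF, hb0, h.ne']
    · have : 1 ≤ q := h0
      simp [h, this, h.ne', h.le, h.not_gt]

theorem shuffle (a b : ℕ) (c d : ℕ → ℝ) (ha : 2 ≤ a) (hb : 2 ≤ b)
    (h : ∀ p q : ℝ, 0 < p → 0 < q → p⁻¹ ^ a * q⁻¹ ^ b = ∑ k ∈ Finset.range 10,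
      (c k * ((p + q)⁻¹ ^ (k + 2) * q⁻¹ ^ (10 - k))
        + d k * ((p + q)⁻¹ ^ (k + 2) * p⁻¹ ^ (10 - k)))) :
    ∑' x, FF a b x = ∑ k ∈ Finset.range 10, (c k + d k) * Ze2 (k + 2) (10 - k) := by
  have hK : ∀ k ∈ Finset.range 10, HasSum (fun x : ℕ × ℕ =>
      c k * KK (k + 2) (10 - k) x + d k * KK (k + 2) (10 - k) x.swap)
      ((c k + d k) * Ze2 (k + 2) (10 - k)) := by
    intro k hk
    have h1 : HasSum (KK (k + 2) (10 - k)) (Ze2 (k + 2) (10 - k)) := by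
      rw [Ze2_KK]; exact (KK_summable k (Finset.mem_range.1 hk)).hasSum
    have h2 : HasSum (fun x : ℕ × ℕ => KK (k + 2) (10 - k) x.swap) (Ze2 (k + 2) (10 - k)) :=
      (Equiv.prodComm ℕ ℕ).hasSum_iff.2 h1
    rw [add_mul]
    exact (h1.mul_left _).add (h2.mul_left _)
  rw [← (hasSum_sum hK).tsum_eq]
  refine tsum_congr ?_
  rintro ⟨p, q⟩
  simp only [Prod.swap, KK_eq]
  by_cases hpq : 1 ≤ p ∧ 1 ≤ q
  · have hqp : 1 ≤ q ∧ 1 ≤ p := hpq.symm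
    have := h p q (by exact_mod_cast hpq.1) (by exact_mod_cast hpq.2)
    simp only [hpq, hqp, and_self, if_true]
    rw [add_comm (q : ℝ) p, ← this]
    simp [FF, zpow_neg]
  · have hqp : ¬ (1 ≤ q ∧ 1 ≤ p) := fun h => hpq h.symm
    simp only [hpq, hqp, if_false]
    have ha0 : a ≠ 0 := by omega
    have hb0 : b ≠ 0 := by omega
    have : p = 0 ∨ q = 0 := by omega
    rcases this with h | h <;> subst h <;> simp [FF, ha0, hb0]

set_option maxHeartbeats 4000000 in
theorem pf (a b : ℕ) (h : (a, b) = (2, 10) ∨ (a, b) = (3, 9) ∨ (a, b) = (4, 8) ∨ (a, b) = (5, 7)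
    ∨ (a, b) = (6, 6)) (p q : ℝ) (hp : 0 < p) (hq : 0 < q) :
    p⁻¹ ^ a * q⁻¹ ^ b = ∑ k ∈ Finset.range 10,
      (((k + 1).choose (a - 1) : ℝ) * ((p + q)⁻¹ ^ (k + 2) * q⁻¹ ^ (10 - k))
        + ((k + 1).choose (b - 1) : ℝ) * ((p + q)⁻¹ ^ (k + 2) * p⁻¹ ^ (10 - k))) := by
  have hpq : p + q ≠ 0 := by positivity
  rcases h with h | h | h | h | h <;> obtain ⟨rfl, rfl⟩ := Prod.mk.inj h <;>
  · simp [Finset.sum_range_succ, Nat.choose]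
    field_simp
    ring

/-- Weight-12 double-zeta identity: vanishing of the coefficient of `Te^1` in the reduction of
the alternal multitangent `Tan^{2,7,4}`. -/
theorem weight12_alternal_double_zeta_identity :
    36 * Ze1 12 + 84 * Ze2 10 2 - 112 * Ze2 9 3 - 168 * Ze2 3 9 + 56 * Ze2 8 4
      + 28 * Ze2 4 8 - 104 * Ze2 7 5 - 112 * Ze2 5 7 + (100 / 3) * Ze2 6 6 = 0 := by
  have t2 := (stuffle 2 10 (by norm_num) (by norm_num)).symm.trans
    (shuffle 2 10 _ _ (by norm_num) (by norm_num) (pf 2 10 (by simp)))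
  have t3 := (stuffle 3 9 (by norm_num) (by norm_num)).symm.trans
    (shuffle 3 9 _ _ (by norm_num) (by norm_num) (pf 3 9 (by simp)))
  have t4 := (stuffle 4 8 (by norm_num) (by norm_num)).symm.trans
    (shuffle 4 8 _ _ (by norm_num) (by norm_num) (pf 4 8 (by simp)))
  have t5 := (stuffle 5 7 (by norm_num) (by norm_num)).symm.trans
    (shuffle 5 7 _ _ (by norm_num) (by norm_num) (pf 5 7 (by simp)))
  have t6 := (stuffle 6 6 (by norm_num) (by norm_num)).symm.trans
    (shuffle 6 6 _ _ (by norm_num) (by norm_num) (pf 6 6 (by simp)))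
  simp [Finset.sum_range_succ, Nat.choose] at t2 t3 t4 t5 t6
  linear_combination 84 * t2 - 280 / 3 * t3 + 84 * t4 - 72 * t5 + 100 / 3 * t6
end

section
/- The Hurwitz-type mould Se₊ is symmetrel: let s′ = (s′_1,…,s′_p) and s″ = (s″_1,…,s″_q) be nonempty sequences of positive integers with s′_1 ≥ 2 and s″_1 ≥ 2. Then for every z ∈ ℂ ∖ ℤ, Se₊^{s′}(z) · Se₊^{s″}(z) = ∑_{w ∈ she(s′,s″)} Se₊^{w}(z), the sum (with multiplicity) running over the multiset she(s′,s″) of contracting shuffles of s′ and s″. -/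
/-- `Se₊^{t₁,…,t_m}(z) = ∑_{n₁ > n₂ > ⋯ > n_m > 0} ∏ (nᵢ + z)^{-tᵢ}`; `Se₊^{∅}(z) = 1`. -/
noncomputable def SeP (t : List ℕ) (z : ℂ) : ℂ :=
  ∑' n : {n : Fin t.length → ℤ // StrictAnti n ∧ ∀ i, 0 < n i},
    ∏ i : Fin t.length, ((n.1 i : ℂ) + z) ^ (-(t.get i : ℤ))

/-- The multiset of contracting shuffles of two sequences: interleavings of the two sequences
(preserving internal orders), with optional merging (sum) of adjacent pairs coming from the two
different sequences. -/
def she : List ℕ → List ℕ → Multiset (List ℕ)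
  | [], t => {t}
  | a :: s, [] => {a :: s}
  | a :: s, b :: t =>
      ((she s (b :: t)).map (a :: ·)) + ((she (a :: s) t).map (b :: ·))
        + ((she s t).map ((a + b) :: ·))
termination_by s t => s.length + t.length

open Filter Topology Finset

/-- Truncated iterated sums. -/
noncomputable def truH {K : Type*} [Field K] (f : ℕ → K) : List ℕ → ℕ → K
  | [], _ => 1
  | a :: s, N => ∑ k ∈ range N, f k ^ a * truH f s k

theorem sum_mul_sum_split {K : Type*} [Field K] (A B : ℕ → K) (N : ℕ) :
    (∑ k ∈ range N, A k) * (∑ k ∈ range N, B k) =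
      (∑ k ∈ range N, A k * ∑ l ∈ range k, B l) + (∑ k ∈ range N, B k * ∑ l ∈ range k, A l)
        + ∑ k ∈ range N, A k * B k := by
  induction N with
  | zero => simp
  | succ n ih =>
    simp only [sum_range_succ]
    linear_combination ih

theorem multiset_sum_cons {K : Type*} [Field K] (f : ℕ → K) (c : ℕ) (S : Multiset (List ℕ)) (N : ℕ) :
    ((S.map (c :: ·)).map (fun w => truH f w N)).sum =
      ∑ k ∈ range N, f k ^ c * (S.map (fun w => truH f w k)).sum := by
  induction S using Multiset.induction_on with
  | empty => simp
  | cons w S ih =>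
    simp only [Multiset.map_cons, Multiset.sum_cons, ih, mul_add, sum_add_distrib, truH]

theorem truH_mul {K : Type*} [Field K] (f : ℕ → K) (s t : List ℕ) (N : ℕ) :
    truH f s N * truH f t N = ((she s t).map (fun w => truH f w N)).sum := by
  induction s, t using she.induct generalizing N with
  | case1 t => simp [she, truH]
  | case2 a s => simp [she, truH]
  | case3 a s b t ih1 ih2 ih3 =>
    rw [she, Multiset.map_add, Multiset.map_add, Multiset.sum_add, Multiset.sum_add,
      multiset_sum_cons, multiset_sum_cons, multiset_sum_cons]
    simp only [← ih1, ← ih2, ← ih3]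
    simp only [truH]
    rw [sum_mul_sum_split]
    congr 1
    · congr 1
      · refine sum_congr rfl fun k _ => by ring
      · refine sum_congr rfl fun k _ => by ring
    · refine sum_congr rfl fun k _ => by ring

theorem she_pos (s t : List ℕ) (hs : ∀ x ∈ s, 0 < x) (ht : ∀ x ∈ t, 0 < x) :
    ∀ w ∈ she s t, ∀ x ∈ w, 0 < x := by
  induction s, t using she.induct with
  | case1 t => simpa [she] using ht
  | case2 a s => simpa [she] using hs
  | case3 a s b t ih1 ih2 ih3 =>
    have hs' : ∀ x ∈ s, 0 < x := fun x hx => hs x (by simp [hx])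
    have ht' : ∀ x ∈ t, 0 < x := fun x hx => ht x (by simp [hx])
    have ha : 0 < a := hs a (by simp)
    have hb : 0 < b := ht b (by simp)
    intro w hw
    rw [she] at hw
    simp only [Multiset.mem_add, Multiset.mem_map] at hw
    rcases hw with (⟨v, hv, rfl⟩ | ⟨v, hv, rfl⟩) | ⟨v, hv, rfl⟩
    · intro x hx
      rcases List.mem_cons.1 hx with rfl | hx
      · exact ha
      · exact ih1 hs' ht v hv x hx
    · intro x hx
      rcases List.mem_cons.1 hx with rfl | hx
      · exact hb
      · exact ih2 hs ht' v hv x hx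
    · intro x hx
      rcases List.mem_cons.1 hx with rfl | hx
      · omega
      · exact ih3 hs' ht' v hv x hx

theorem she_head (s t : List ℕ) (hs : 2 ≤ s.headI) (ht : 2 ≤ t.headI) :
    ∀ w ∈ she s t, 2 ≤ w.headI := by
  cases s with
  | nil => simp at hs
  | cons a s =>
    cases t with
    | nil => simp at ht
    | cons b t =>
      simp only [List.headI_cons] at hs ht
      intro w hw
      rw [she] at hw
      simp only [Multiset.mem_add, Multiset.mem_map] at hw
      rcases hw with (⟨v, hv, rfl⟩ | ⟨v, hv, rfl⟩) | ⟨v, hv, rfl⟩ <;> simp only [List.headI_cons] <;> omega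

theorem consInj (m : ℕ) : Function.Injective
    (fun p : (_ : ℕ) × (Fin m → ℤ) => (Fin.cons ((p.1 : ℤ) + 1) p.2 : Fin (m + 1) → ℤ)) := by
  rintro ⟨k, n⟩ ⟨k', n'⟩ h
  have h' := Fin.cons_injective2 h
  obtain ⟨h1, h2⟩ := h'
  simp only at h1 h2
  have : k = k' := by omega
  subst this
  subst h2
  rfl

/-- The strictly decreasing tuples with entries in `[1, N]`. -/
def tup : (m : ℕ) → ℕ → Finset (Fin m → ℤ)
  | 0, _ => {Fin.elim0}
  | m + 1, N => ((range N).sigma (fun k => tup m k)).map ⟨_, consInj m⟩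

theorem mem_tup (m N : ℕ) (n : Fin m → ℤ) :
    n ∈ tup m N ↔ (StrictAnti n ∧ ∀ i, 0 < n i) ∧ ∀ i, n i ≤ N := by
  induction m generalizing N with
  | zero =>
    have : n = Fin.elim0 := Subsingleton.elim _ _
    simp [tup, this, Subsingleton.strictAnti]
  | succ m ih =>
    simp only [tup, Finset.mem_map, mem_sigma, mem_range, Function.Embedding.coeFn_mk]
    constructor
    · rintro ⟨⟨k, n⟩, ⟨hk, hn⟩, rfl⟩
      obtain ⟨⟨h1, h2⟩, h3⟩ := (ih _ _).1 hn
      simp only at hk h1 h2 h3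
      refine ⟨⟨?_, ?_⟩, ?_⟩
      · intro i j hij
        induction j using Fin.cases with
        | zero => exact absurd hij (Fin.not_lt_zero i)
        | succ j =>
          induction i using Fin.cases with
          | zero => simp only [Fin.cons_zero, Fin.cons_succ]; have := h3 j; omega
          | succ i => simp only [Fin.cons_succ]; exact h1 (Fin.succ_lt_succ_iff.1 hij)
      · intro i
        induction i using Fin.cases with
        | zero => simp only [Fin.cons_zero]; omega
        | succ i => simpa using h2 i
      · intro i
        induction i using Fin.cases with
        | zero => simp only [Fin.cons_zero]; omega
        | succ i => simp only [Fin.cons_succ]; have := h3 i; omega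
    · rintro ⟨⟨h1, h2⟩, h3⟩
      have h0 := h2 0
      have h30 := h3 0
      refine ⟨⟨(n 0 - 1).toNat, Fin.tail n⟩, ⟨?_, ?_⟩, ?_⟩
      · simp only; omega
      · rw [ih]
        refine ⟨⟨?_, ?_⟩, ?_⟩
        · intro i j hij
          exact h1 (Fin.succ_lt_succ_iff.2 hij)
        · intro i; exact h2 _
        · intro i
          have : n i.succ < n 0 := h1 (Fin.succ_pos i)
          simp only [Fin.tail]
          omega
      · have : (((n 0 - 1).toNat : ℕ) : ℤ) + 1 = n 0 := by omega
        simp only [this]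
        exact Fin.cons_self_tail n

theorem sum_tup {K : Type*} [Field K] (g : ℤ → K) (t : List ℕ) (N : ℕ) :
    ∑ n ∈ tup t.length N, ∏ i : Fin t.length, g (n i) ^ (t.get i) =
      truH (fun k => g ((k : ℤ) + 1)) t N := by
  induction t generalizing N with
  | nil => simp [tup, truH]
  | cons a s ih =>
    simp only [truH, ← ih]
    simp only [List.length_cons, tup, sum_map, sum_sigma, Function.Embedding.coeFn_mk]
    refine sum_congr rfl fun k _ => ?_
    rw [mul_sum]
    refine sum_congr rfl fun n _ => ?_
    rw [Fin.prod_univ_succ]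
    simp

theorem truH_nonneg (f : ℕ → ℝ) (hf : ∀ k, 0 ≤ f k) (s : List ℕ) (N : ℕ) : 0 ≤ truH f s N := by
  induction s generalizing N with
  | nil => simp [truH]
  | cons a s ih => exact sum_nonneg fun k _ => mul_nonneg (pow_nonneg (hf k) _) (ih k)

theorem truH_bound (f : ℕ → ℝ) (hf : ∀ k, 0 ≤ f k) (C : ℝ) (hC : 0 ≤ C)
    (hfC : ∀ k, f k ≤ C * ((k : ℝ) + 1)⁻¹) (s : List ℕ) (hs : ∀ x ∈ s, 0 < x) :
    ∃ M, 0 ≤ M ∧ ∀ N, truH f s N ≤ M * (∑ k ∈ range N, ((k : ℝ) + 1)⁻¹) ^ s.length := by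
  induction s with
  | nil => exact ⟨1, by norm_num, fun N => by simp [truH]⟩
  | cons a s ih =>
    obtain ⟨M, hM, h⟩ := ih fun x hx => hs x (by simp [hx])
    have ha : 0 < a := hs a (by simp)
    refine ⟨C ^ a * M, by positivity, fun N => ?_⟩
    simp only [truH, List.length_cons]
    have key : ∀ k ∈ range N, f k ^ a * truH f s k ≤
        ((k : ℝ) + 1)⁻¹ * (C ^ a * M * (∑ k ∈ range N, ((k : ℝ) + 1)⁻¹) ^ s.length) := by
      intro k hk
      have h1 : f k ^ a ≤ C ^ a * ((k : ℝ) + 1)⁻¹ := by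
        calc f k ^ a ≤ (C * ((k : ℝ) + 1)⁻¹) ^ a := pow_le_pow_left₀ (hf k) (hfC k) a
          _ = C ^ a * (((k : ℝ) + 1)⁻¹) ^ a := mul_pow _ _ _
          _ ≤ C ^ a * ((k : ℝ) + 1)⁻¹ := by
            refine mul_le_mul_of_nonneg_left ?_ (by positivity)
            refine pow_le_of_le_one (by positivity) ?_ ha.ne'
            refine inv_le_one_of_one_le₀ ?_
            have : (0 : ℝ) ≤ k := by positivity
            linarith
      have h2 : truH f s k ≤ M * (∑ k ∈ range N, ((k : ℝ) + 1)⁻¹) ^ s.length := by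
        refine (h k).trans (mul_le_mul_of_nonneg_left ?_ hM)
        refine pow_le_pow_left₀ (sum_nonneg fun _ _ => by positivity) ?_ _
        refine sum_le_sum_of_subset_of_nonneg ?_ fun _ _ _ => by positivity
        exact range_subset_range.2 (mem_range.1 hk).le
      calc _ ≤ (C ^ a * ((k : ℝ) + 1)⁻¹) * (M * (∑ k ∈ range N, ((k : ℝ) + 1)⁻¹) ^ s.length) :=
            mul_le_mul h1 h2 (truH_nonneg f hf s k) (by positivity)
        _ = _ := by ring
    refine (sum_le_sum key).trans (le_of_eq ?_)
    rw [← sum_mul]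
    ring

theorem summable_aux (m : ℕ) :
    Summable fun N : ℕ => (((N : ℝ) + 1)⁻¹) ^ 2 * (∑ k ∈ range N, ((k : ℝ) + 1)⁻¹) ^ m := by
  have h1 : (fun x : ℝ => (1 + Real.log x) ^ m) =o[atTop] fun x => x ^ (1 / 2 : ℝ) := by
    have h0 : (fun x : ℝ => 1 + Real.log x) =O[atTop] Real.log := by
      refine Asymptotics.IsBigO.add ?_ (Asymptotics.isBigO_refl _ _)
      exact (Real.isLittleO_const_log_atTop).isBigO
    have h2 := (h0.pow m)
    refine h2.trans_isLittleO ?_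
    have := isLittleO_log_rpow_rpow_atTop (s := 1 / 2) (m : ℝ) (by norm_num)
    simpa [Real.rpow_natCast] using this
  have h2 := (h1.comp_tendsto tendsto_natCast_atTop_atTop).isBigO
  have h3 : (fun N : ℕ => (∑ k ∈ range N, ((k : ℝ) + 1)⁻¹) ^ m) =O[atTop]
      fun N : ℕ => (N : ℝ) ^ (1 / 2 : ℝ) := by
    refine Asymptotics.IsBigO.trans ?_ h2
    refine Asymptotics.IsBigO.of_bound 1 (Eventually.of_forall fun N => ?_)
    have hn : 0 ≤ ∑ k ∈ range N, ((k : ℝ) + 1)⁻¹ := sum_nonneg fun _ _ => by positivity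
    have hle : ∑ k ∈ range N, ((k : ℝ) + 1)⁻¹ ≤ 1 + Real.log N := by
      have := harmonic_le_one_add_log N
      simpa [harmonic] using this
    simp only [Function.comp, one_mul, norm_pow]
    refine pow_le_pow_left₀ (norm_nonneg _) ?_ m
    rw [Real.norm_of_nonneg hn]
    exact hle.trans (le_abs_self _)
  have h4 : (fun N : ℕ => (((N : ℝ) + 1)⁻¹) ^ 2) =O[atTop] fun N : ℕ => (N : ℝ) ^ (-2 : ℝ) := by
    refine Asymptotics.IsBigO.of_bound 1 ?_
    filter_upwards [eventually_gt_atTop 0] with N hN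
    have hN' : (0 : ℝ) < N := by exact_mod_cast hN
    rw [one_mul, Real.norm_of_nonneg (by positivity), Real.norm_of_nonneg (by positivity),
      Real.rpow_neg hN'.le, Real.rpow_two, inv_pow]
    gcongr
    linarith
  have h5 := h4.mul h3
  refine summable_of_isBigO_nat (g := fun N : ℕ => (N : ℝ) ^ (-(3 / 2) : ℝ)) ?_ (h5.trans ?_)
  · exact Real.summable_nat_rpow.2 (by norm_num)
  · refine Asymptotics.IsBigO.of_bound 1 ?_
    filter_upwards [eventually_gt_atTop 0] with N hN
    have hN' : (0 : ℝ) < N := by exact_mod_cast hN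
    rw [← Real.rpow_add hN', one_mul]
    norm_num

theorem truH_bdd (f : ℕ → ℝ) (hf : ∀ k, 0 ≤ f k) (C : ℝ) (hC : 0 ≤ C)
    (hfC : ∀ k, f k ≤ C * ((k : ℝ) + 1)⁻¹) (s : List ℕ) (hs : ∀ x ∈ s, 0 < x)
    (h2 : 2 ≤ s.headI) : ∃ B, ∀ N, truH f s N ≤ B := by
  cases s with
  | nil => simp at h2
  | cons a s =>
    simp only [List.headI_cons] at h2
    obtain ⟨M, hM, h⟩ := truH_bound f hf C hC hfC s fun x hx => hs x (by simp [hx])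
    have hsum := (summable_aux s.length).mul_left (C ^ a * M)
    refine ⟨_, fun N => le_trans ?_ (hsum.sum_le_tsum (range N) fun k _ => ?_)⟩
    · refine sum_le_sum fun k _ => ?_
      have h1 : f k ^ a ≤ C ^ a * (((k : ℝ) + 1)⁻¹) ^ 2 := by
        calc f k ^ a ≤ (C * ((k : ℝ) + 1)⁻¹) ^ a := pow_le_pow_left₀ (hf k) (hfC k) a
          _ = C ^ a * (((k : ℝ) + 1)⁻¹) ^ a := mul_pow _ _ _
          _ ≤ C ^ a * (((k : ℝ) + 1)⁻¹) ^ 2 := by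
            refine mul_le_mul_of_nonneg_left ?_ (by positivity)
            refine pow_le_pow_of_le_one (by positivity) ?_ h2
            refine inv_le_one_of_one_le₀ ?_
            have : (0 : ℝ) ≤ k := by positivity
            linarith
      refine (mul_le_mul h1 (h k) (truH_nonneg f hf s k) (by positivity)).trans (le_of_eq ?_)
      ring
    · have : 0 ≤ ∑ l ∈ range k, ((l : ℝ) + 1)⁻¹ := sum_nonneg fun _ _ => by positivity
      positivity

theorem exists_bound (z : ℂ) :
    ∃ C : ℝ, 0 ≤ C ∧ ∀ k : ℕ, ‖((((k : ℤ) + 1 : ℤ) : ℂ) + z)⁻¹‖ ≤ C * ((k : ℝ) + 1)⁻¹ := by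
  have h : Asymptotics.IsBigO atTop (fun k : ℕ => ((((k : ℤ) + 1 : ℤ) : ℂ) + z)⁻¹)
      (fun k : ℕ => ((k : ℝ) + 1)⁻¹) := by
    refine Asymptotics.IsBigO.of_bound 2 ?_
    filter_upwards [tendsto_natCast_atTop_atTop.eventually_ge_atTop (2 * ‖z‖)] with k hk
    have hk0 : (0 : ℝ) < (k : ℝ) + 1 := by positivity
    have h1 : ((k : ℝ) + 1) / 2 ≤ ‖((((k : ℤ) + 1 : ℤ) : ℂ) + z)‖ := by
      have h2 : ‖(((k : ℤ) + 1 : ℤ) : ℂ)‖ = (k : ℝ) + 1 := by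
        rw [Complex.norm_intCast]; push_cast; exact abs_of_pos hk0
      have h3 := norm_sub_le ((((k : ℤ) + 1 : ℤ) : ℂ) + z) z
      rw [add_sub_cancel_right, h2] at h3
      linarith
    rw [norm_inv, Real.norm_of_nonneg (by positivity)]
    refine (inv_anti₀ (by positivity) h1).trans (le_of_eq ?_)
    field_simp
  obtain ⟨C, hC, hb⟩ := Asymptotics.bound_of_isBigO_nat_atTop h
  refine ⟨C, hC.le, fun k => ?_⟩
  have hk0 : (0 : ℝ) < (k : ℝ) + 1 := by positivity
  have := hb (x := k) (inv_ne_zero hk0.ne')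
  rwa [Real.norm_of_nonneg (by positivity : (0 : ℝ) ≤ ((k : ℝ) + 1)⁻¹)] at this

theorem tendsto_truH (z : ℂ) (t : List ℕ) (ht : ∀ x ∈ t, 0 < x) (h2 : 2 ≤ t.headI) :
    Tendsto (fun N => truH (fun k : ℕ => ((((k : ℤ) + 1 : ℤ) : ℂ) + z)⁻¹) t N) atTop
      (𝓝 (SeP t z)) := by
  classical
  obtain ⟨C, hC, hb⟩ := exists_bound z
  obtain ⟨B, hB⟩ := truH_bdd (fun k : ℕ => ‖((((k : ℤ) + 1 : ℤ) : ℂ) + z)⁻¹‖)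
    (fun _ => norm_nonneg _) C hC hb t ht h2
  let P : (Fin t.length → ℤ) → Prop := fun n => StrictAnti n ∧ ∀ i, 0 < n i
  let u : ℕ → Finset {n // P n} := fun N => (tup t.length N).subtype P
  have hu : Tendsto u atTop atTop := by
    refine tendsto_atTop_finset_of_monotone ?_ ?_
    · intro N N' h n hn
      simp only [u, mem_subtype, mem_tup] at hn ⊢
      exact ⟨hn.1, fun i => (hn.2 i).trans (by exact_mod_cast h)⟩
    · intro n
      refine ⟨(∑ i, n.1 i).toNat, ?_⟩
      simp only [u, mem_subtype, mem_tup]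
      refine ⟨n.2, fun i => ?_⟩
      have := single_le_sum (f := n.1) (fun j _ => (n.2.2 j).le) (mem_univ i)
      omega
  have hsum : ∀ {K : Type} [Field K] (g : ℤ → K) (N : ℕ),
      ∑ n ∈ u N, ∏ i : Fin t.length, g (n.1 i) ^ (t.get i) =
        truH (fun k => g ((k : ℤ) + 1)) t N := by
    intro K _ g N
    rw [← sum_tup]
    exact sum_subtype_of_mem (fun n : Fin t.length → ℤ => ∏ i : Fin t.length, g (n i) ^ (t.get i))
      (fun n hn => ((mem_tup _ _ _).1 hn).1)
  have hS : Summable fun n : {n // P n} =>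
      ∏ i : Fin t.length, ((n.1 i : ℂ) + z)⁻¹ ^ (t.get i) := by
    refine Summable.of_norm ?_
    refine summable_of_sum_le (c := B) (fun _ => norm_nonneg _) fun v => ?_
    obtain ⟨N, hN⟩ := (hu.eventually_ge_atTop v).exists
    refine (sum_le_sum_of_subset_of_nonneg hN fun _ _ _ => norm_nonneg _).trans ?_
    refine le_trans (le_of_eq ?_) (hB N)
    rw [← hsum (fun n : ℤ => ‖((n : ℂ) + z)⁻¹‖)]
    simp only [norm_prod, norm_pow]
  have h3 := hS.hasSum.comp hu
  have h4 : SeP t z = ∑' n : {n // P n}, ∏ i : Fin t.length, ((n.1 i : ℂ) + z)⁻¹ ^ (t.get i) := by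
    unfold SeP
    simp only [zpow_neg, zpow_natCast, inv_pow]
    rfl
  rw [h4]
  refine h3.congr fun N => ?_
  exact hsum (fun n : ℤ => ((n : ℂ) + z)⁻¹) N

/-- The Hurwitz-type mould `Se₊` is symmetrel. -/
theorem SeP_symmetrel
    (s' s'' : List ℕ) (h' : s' ≠ []) (h'' : s'' ≠ [])
    (hpos' : ∀ x ∈ s', 0 < x) (hpos'' : ∀ x ∈ s'', 0 < x)
    (hfirst' : 2 ≤ s'.headI) (hfirst'' : 2 ≤ s''.headI)
    (z : ℂ) (hz : ∀ n : ℤ, z ≠ (n : ℂ)) :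
    SeP s' z * SeP s'' z = ((she s' s'').map (fun w => SeP w z)).sum := by
  have h1 := (tendsto_truH z s' hpos' hfirst').mul (tendsto_truH z s'' hpos'' hfirst'')
  have h2 := tendsto_multiset_sum (she s' s'') (fun w hw =>
    tendsto_truH z w (she_pos s' s'' hpos' hpos'' w hw) (she_head s' s'' hfirst' hfirst'' w hw))
  refine tendsto_nhds_unique h1 (h2.congr fun N => ?_)
  exact (truH_mul _ s' s'' N).symm
end

section
/- Depth-3 alternal multitangent identity: for all integers n_1, n_2, n_3 ≥ 2 and every z ∈ ℂ ∖ ℤ, Tan^{n_1,n_2,n_3}(z) = (1/3)Te^{n_1,n_2,n_3}(z) − (1/6)Te^{n_1,n_3,n_2}(z) − (1/6)Te^{n_2,n_1,n_3}(z) − (1/6)Te^{n_2,n_3,n_1}(z) − (1/6)Te^{n_3,n_1,n_2}(z) + (1/3)Te^{n_3,n_2,n_1}(z) − (1/6)Te^{n_1+n_3,n_2}(z) + (1/12)Te^{n_1,n_2+n_3}(z) + (1/12)Te^{n_1+n_2,n_3}(z) + (1/12)Te^{n_3,n_1+n_2}(z) + (1/12)Te^{n_2+n_3,n_1}(z) −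 (1/6)Te^{n_2,n_1+n_3}(z). -/
/-- Multitangent function: `Te^{s₁,…,s_r}(z) = ∑_{n₁ > n₂ > ⋯ > n_r, nᵢ ∈ ℤ} ∏ (nᵢ + z)^{-sᵢ}`;
`Te^{∅}(z) = 1`. -/
noncomputable def Te (s : List ℕ) (z : ℂ) : ℂ :=
  ∑' n : {n : Fin s.length → ℤ // StrictAnti n},
    ∏ i : Fin s.length, ((n.1 i : ℂ) + z) ^ (-(s.get i : ℤ))

/-- The mould logarithm of `Te`:
`Ten^{t₁,…,t_m}(z) = ∑_{j=1}^m ((−1)^{j−1}/j) ∑ ∏_{i=1}^j Te^{tⁱ}(z)`, the inner sum running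
over all decompositions of `(t₁,…,t_m)` into `j` consecutive nonempty blocks `t¹,…,tʲ`. -/
noncomputable def Ten (t : List ℕ) (z : ℂ) : ℂ :=
  ∑ c : Composition t.length,
    ((-1 : ℂ)) ^ (c.length - 1) / (c.length : ℂ) *
      ((t.splitWrtComposition c).map (fun b => Te b z)).prod

/-- The alternal multitangent, `Tan = logmu(Te) ∘ (E−1)`:
`Tan^{s₁,…,s_r}(z) = ∑ (∏_{j=1}^k 1/ℓⱼ!) · Ten^{b₁,…,b_k}(z)`, the sum running over all
decompositions of `(s₁,…,s_r)` into `k ≥ 1` consecutive nonempty blocks, where `ℓⱼ` is the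
length and `bⱼ` the sum of the `j`-th block. -/
noncomputable def Tan (s : List ℕ) (z : ℂ) : ℂ :=
  ∑ c : Composition s.length,
    (((s.splitWrtComposition c).map (fun b => (1 : ℂ) / (b.length.factorial : ℂ))).prod) *
      Ten ((s.splitWrtComposition c).map List.sum) z

def c111 : Composition 3 := ⟨[1,1,1], by simp, by simp⟩
def c12 : Composition 3 := ⟨[1,2], by simp, by simp⟩
def c21 : Composition 3 := ⟨[2,1], by simp, by simp⟩
def c3 : Composition 3 := ⟨[3], by simp, by simp⟩
def c11 : Composition 2 := ⟨[1,1], by simp, by simp⟩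
def c2 : Composition 2 := ⟨[2], by simp, by simp⟩
def c1 : Composition 1 := ⟨[1], by simp, by simp⟩
lemma u1 : (Finset.univ : Finset (Composition 1)) = {c1} :=
  (Finset.eq_univ_of_card _ (by rw [composition_card]; decide)).symm
lemma u2 : (Finset.univ : Finset (Composition 2)) = {c11,c2} :=
  (Finset.eq_univ_of_card _ (by rw [composition_card]; decide)).symm
lemma u3 : (Finset.univ : Finset (Composition 3)) = {c111,c12,c21,c3} :=
  (Finset.eq_univ_of_card _ (by rw [composition_card]; decide)).symm

noncomputable def DD (f g : ℤ → ℂ) : ℂ := ∑' p : ℤ × ℤ, if p.2 < p.1 then f p.1 * g p.2 else 0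
noncomputable def TT (f g h : ℤ → ℂ) : ℂ :=
  ∑' p : ℤ × ℤ × ℤ, if p.2.1 < p.1 ∧ p.2.2 < p.2.1 then f p.1 * (g p.2.1 * h p.2.2) else 0

lemma sum_ite {ι} (P : ι → Prop) [DecidablePred P] (F : ι → ℂ) (hF : Summable F) :
    Summable fun p => if P p then F p else 0 := by
  have := hF.indicator {p | P p}
  refine this.congr fun p => ?_
  simp [Set.indicator]

lemma L1 (f g : ℤ → ℂ) (hf : Summable f) (hg : Summable g) :
    (∑' n, f n) * (∑' n, g n) = DD f g + DD g f + ∑' n, f n * g n := by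
  have hs : Summable fun p : ℤ × ℤ => f p.1 * g p.2 := summable_mul_of_summable_norm hf.norm hg.norm
  have e1 : DD g f = ∑' p : ℤ × ℤ, if p.1 < p.2 then f p.1 * g p.2 else 0 := by
    unfold DD
    rw [← (Equiv.prodComm ℤ ℤ).tsum_eq]
    simp [mul_comm]
  have e2 : ∑' n, f n * g n = ∑' p : ℤ × ℤ, if p.1 = p.2 then f p.1 * g p.2 else 0 := by
    have hi : Function.Injective (fun n : ℤ => (n, n)) := fun a b h => by simpa using h
    rw [← hi.tsum_eq]
    · simp
    · rintro ⟨a, b⟩ h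
      simp at h
      exact ⟨a, by simp [h.1]⟩
  rw [tsum_mul_tsum_of_summable_norm hf.norm hg.norm, e1, e2]
  unfold DD
  rw [← Summable.tsum_add (sum_ite _ _ hs) (sum_ite _ _ hs), ← Summable.tsum_add
     ((sum_ite _ _ hs).add (sum_ite _ _ hs)) (sum_ite _ _ hs)]
  congr 1; ext ⟨a, b⟩
  rcases lt_trichotomy a b with h | h | h
  · simp [h, h.not_gt, h.ne]
  · simp [h]
  · simp [h, h.not_gt, h.ne']

lemma sum5 {ι} (A B C D E : ι → ℂ) (hA : Summable A) (hB : Summable B) (hC : Summable C)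
    (hD : Summable D) (hE : Summable E) : ∑' p, (A p + B p + C p + D p + E p) =
    ∑' p, A p + ∑' p, B p + ∑' p, C p + ∑' p, D p + ∑' p, E p :=
  ((((hA.hasSum.add hB.hasSum).add hC.hasSum).add hD.hasSum).add hE.hasSum).tsum_eq

lemma pt (a b c : ℤ) (x y w : ℂ) : x * (if c < b then y * w else 0) =
    (if b < a ∧ c < b then x * (y * w) else 0) + (if a < b ∧ c < a then x * (y * w) else 0)
    + (if c < b ∧ a < c then x * (y * w) else 0) + (if a = b ∧ c < b then x * (y * w) else 0)
    + (if a = c ∧ c < b then x * (y * w) else 0) := by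
  generalize hu : x * (y * w) = u
  rw [mul_ite, mul_zero, hu]
  split_ifs <;> first | (exfalso; omega) | simp

lemma L2e1 (f g h : ℤ → ℂ) : TT g f h = ∑' p : ℤ × ℤ × ℤ, if p.1 < p.2.1 ∧ p.2.2 < p.1 then
      f p.1 * (g p.2.1 * h p.2.2) else 0 := by
    unfold TT
    let e : ℤ × ℤ × ℤ ≃ ℤ × ℤ × ℤ := ⟨fun p => (p.2.1, p.1, p.2.2), fun p => (p.2.1, p.1, p.2.2),
      fun p => rfl, fun p => rfl⟩
    rw [← e.tsum_eq]
    simp only [e, Equiv.coe_fn_mk]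
    congr 1; ext p; congr 1; ring

lemma L2e2 (f g h : ℤ → ℂ) : TT g h f = ∑' p : ℤ × ℤ × ℤ, if p.2.2 < p.2.1 ∧ p.1 < p.2.2 then
      f p.1 * (g p.2.1 * h p.2.2) else 0 := by
    unfold TT
    let e : ℤ × ℤ × ℤ ≃ ℤ × ℤ × ℤ := ⟨fun p => (p.2.1, p.2.2, p.1), fun p => (p.2.2, p.1, p.2.1),
      fun p => rfl, fun p => rfl⟩
    rw [← e.tsum_eq]
    simp only [e, Equiv.coe_fn_mk]
    congr 1; ext p; congr 1; ring

lemma L2e3 (f g h : ℤ → ℂ) : DD (fun n => f n * g n) h =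
    ∑' p : ℤ × ℤ × ℤ, if p.1 = p.2.1 ∧ p.2.2 < p.2.1 then
      f p.1 * (g p.2.1 * h p.2.2) else 0 := by
    have hi : Function.Injective (fun n : ℤ × ℤ => (n.1, n.1, n.2)) := fun a b h => by
      simp at h; ext <;> simp [h]
    rw [← hi.tsum_eq]
    · simp [DD, mul_assoc]
    · rintro ⟨a, b, c⟩ h
      simp at h
      exact ⟨(a, c), by simp [h.1]⟩

lemma L2e4 (f g h : ℤ → ℂ) : DD g (fun n => f n * h n) = ∑' p : ℤ × ℤ × ℤ, if p.1 = p.2.2 ∧ p.2.2 < p.2.1 then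
      f p.1 * (g p.2.1 * h p.2.2) else 0 := by
    have hi : Function.Injective (fun n : ℤ × ℤ => (n.2, n.1, n.2)) := fun a b h => by
      simp at h; ext <;> simp [h]
    rw [← hi.tsum_eq]
    · simp [DD, mul_left_comm]
    · rintro ⟨a, b, c⟩ h
      simp at h
      exact ⟨(b, c), by simp [h.1]⟩

lemma summ_mul {ι κ : Type} (u : ι → ℂ) (v : κ → ℂ) (hu : Summable u) (hv : Summable v) :
    Summable fun p : ι × κ => u p.1 * v p.2 := by
  have h1 : Summable fun i => ‖u i‖ := hu.norm
  have h2 : Summable fun i => ‖v i‖ := hv.norm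
  exact summable_mul_of_summable_norm h1 h2

lemma L2 (f g h : ℤ → ℂ) (hf : Summable f) (hg : Summable g) (hh : Summable h) :
    (∑' n, f n) * DD g h = TT f g h + TT g f h + TT g h f + DD (fun n => f n * g n) h
      + DD g (fun n => f n * h n) := by
  have hs0 : Summable fun p : ℤ × ℤ => g p.1 * h p.2 := summ_mul g h hg hh
  have hs : Summable fun p : ℤ × ℤ × ℤ => f p.1 * (g p.2.1 * h p.2.2) :=
    summ_mul f (fun p : ℤ × ℤ => g p.1 * h p.2) hf hs0
  rw [L2e1 f g h, L2e2 f g h, L2e3 f g h, L2e4 f g h]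
  unfold DD TT
  have s0 := sum_ite (fun p : ℤ × ℤ => p.2 < p.1) _ hs0
  rw [tsum_mul_tsum_of_summable_norm hf.norm s0.norm]
  have s1 := sum_ite (fun p : ℤ × ℤ × ℤ => p.2.1 < p.1 ∧ p.2.2 < p.2.1) _ hs
  have s2 := sum_ite (fun p : ℤ × ℤ × ℤ => p.1 < p.2.1 ∧ p.2.2 < p.1) _ hs
  have s3 := sum_ite (fun p : ℤ × ℤ × ℤ => p.2.2 < p.2.1 ∧ p.1 < p.2.2) _ hs
  have s4 := sum_ite (fun p : ℤ × ℤ × ℤ => p.1 = p.2.1 ∧ p.2.2 < p.2.1) _ hs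
  have s5 := sum_ite (fun p : ℤ × ℤ × ℤ => p.1 = p.2.2 ∧ p.2.2 < p.2.1) _ hs
  rw [← sum5 _ _ _ _ _ s1 s2 s3 s4 s5]
  exact tsum_congr fun p => pt p.1 p.2.1 p.2.2 _ _ _

noncomputable def ff (z : ℂ) (a : ℕ) (n : ℤ) : ℂ := ((n : ℂ) + z) ^ (-(a : ℤ))

lemma ff_add (z : ℂ) (hz : ∀ n : ℤ, z ≠ (n : ℂ)) (a b : ℕ) :
    ff z (a + b) = fun n => ff z a n * ff z b n := by
  ext n
  have : (n : ℂ) + z ≠ 0 := fun h => hz (-n) (by push_cast; linear_combination h)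
  unfold ff
  rw [← zpow_add₀ this]; push_cast; ring_nf

lemma ff_sum (z : ℂ) (a : ℕ) (ha : 2 ≤ a) : Summable (ff z a) := by
  have := EisensteinSeries.linear_right_summable z 1 (k := a) (by exact_mod_cast ha)
  refine this.congr fun n => ?_
  simp [ff, add_comm]

lemma Te1 (a : ℕ) (z : ℂ) : Te [a] z = ∑' n, ff z a n := by
  unfold Te
  let e : {n : Fin 1 → ℤ // StrictAnti n} ≃ ℤ := ⟨fun n => n.1 0, fun n => ⟨fun _ => n,
    Subsingleton.strictAnti _⟩, fun n => by ext i; fin_cases i; rfl, fun n => rfl⟩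
  rw [← e.tsum_eq]
  refine tsum_congr fun n => ?_
  exact Fin.prod_univ_one _

lemma Te2 (a b : ℕ) (z : ℂ) : Te [a, b] z = DD (ff z a) (ff z b) := by
  unfold Te DD
  let i : {n : Fin 2 → ℤ // StrictAnti n} → ℤ × ℤ := fun n => (n.1 0, n.1 1)
  have hi : Function.Injective i := by
    intro n m h
    simp only [i, Prod.mk.injEq] at h
    ext j; fin_cases j
    exacts [h.1, h.2]
  rw [← hi.tsum_eq]
  · refine tsum_congr fun n => ?_
    have : n.1 1 < n.1 0 := n.2 (show (0 : Fin 2) < 1 by decide)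
    simp only [i, this, if_true]
    exact Fin.prod_univ_two _
  · rintro ⟨x, y⟩ h
    simp only [Function.mem_support, ne_eq, ite_eq_right_iff, Classical.not_imp] at h
    refine ⟨⟨![x, y], ?_⟩, by simp [i]⟩
    rw [Fin.strictAnti_iff_succ_lt]
    intro j; fin_cases j; exact h.1

lemma Te3 (a b c : ℕ) (z : ℂ) : Te [a, b, c] z = TT (ff z a) (ff z b) (ff z c) := by
  unfold Te TT
  let i : {n : Fin 3 → ℤ // StrictAnti n} → ℤ × ℤ × ℤ := fun n => (n.1 0, n.1 1, n.1 2)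
  have hi : Function.Injective i := by
    intro n m h
    simp only [i, Prod.mk.injEq] at h
    ext j; fin_cases j
    exacts [h.1, h.2.1, h.2.2]
  rw [← hi.tsum_eq]
  · refine tsum_congr fun n => ?_
    have : n.1 1 < n.1 0 := n.2 (show (0 : Fin 3) < 1 by decide)
    have h2 : n.1 2 < n.1 1 := n.2 (show (1 : Fin 3) < 2 by decide)
    simp only [i, this, h2, if_true, and_self]
    rw [← mul_assoc]
    exact Fin.prod_univ_three _
  · rintro ⟨x, y, w⟩ h
    simp only [Function.mem_support, ne_eq, ite_eq_right_iff, Classical.not_imp] at h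
    refine ⟨⟨![x, y, w], ?_⟩, by simp [i]⟩
    rw [Fin.strictAnti_iff_succ_lt]
    intro j; fin_cases j
    exacts [h.1.1, h.1.2]

lemma Ten1 (a : ℕ) (z : ℂ) : Ten [a] z = Te [a] z := by
  change ∑ c : Composition 1, _ = _
  rw [u1]
  simp [c1, Composition.length, List.splitWrtComposition, List.splitWrtCompositionAux]

lemma Ten2 (a b : ℕ) (z : ℂ) : Ten [a, b] z = Te [a, b] z - 1/2 * (Te [a] z * Te [b] z) := by
  change ∑ c : Composition 2, _ = _
  rw [u2, Finset.sum_insert (by decide), Finset.sum_singleton]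
  simp [c11, c2, Composition.length, List.splitWrtComposition, List.splitWrtCompositionAux]
  ring

lemma Ten3 (a b c : ℕ) (z : ℂ) : Ten [a, b, c] z = Te [a, b, c] z
    - 1/2 * (Te [a] z * Te [b, c] z + Te [a, b] z * Te [c] z)
    + 1/3 * (Te [a] z * (Te [b] z * Te [c] z)) := by
  change ∑ c : Composition 3, _ = _
  rw [u3, Finset.sum_insert (by decide), Finset.sum_insert (by decide),
    Finset.sum_insert (by decide), Finset.sum_singleton]
  simp [c111, c12, c21, c3, Composition.length, List.splitWrtComposition,
    List.splitWrtCompositionAux]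
  ring

lemma Tan3 (a b c : ℕ) (z : ℂ) : Tan [a, b, c] z = Ten [a, b, c] z + 1/2 * Ten [a + b, c] z
    + 1/2 * Ten [a, b + c] z + 1/6 * Ten [a + b + c] z := by
  change ∑ c : Composition 3, _ = _
  rw [u3, Finset.sum_insert (by decide), Finset.sum_insert (by decide),
    Finset.sum_insert (by decide), Finset.sum_singleton]
  simp [c111, c12, c21, c3, List.splitWrtComposition,
    List.splitWrtCompositionAux, Nat.factorial, add_assoc]
  ring

/-- Depth-3 alternal multitangent identity. -/
theorem Tan_depth_three (n₁ n₂ n₃ : ℕ) (h₁ : 2 ≤ n₁) (h₂ : 2 ≤ n₂) (h₃ : 2 ≤ n₃)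
    (z : ℂ) (hz : ∀ n : ℤ, z ≠ (n : ℂ)) :
    Tan [n₁, n₂, n₃] z =
      (1 / 3 : ℂ) * Te [n₁, n₂, n₃] z
      - (1 / 6 : ℂ) * Te [n₁, n₃, n₂] z
      - (1 / 6 : ℂ) * Te [n₂, n₁, n₃] z
      - (1 / 6 : ℂ) * Te [n₂, n₃, n₁] z
      - (1 / 6 : ℂ) * Te [n₃, n₁, n₂] z
      + (1 / 3 : ℂ) * Te [n₃, n₂, n₁] z
      - (1 / 6 : ℂ) * Te [n₁ + n₃, n₂] z
      + (1 / 12 : ℂ) * Te [n₁, n₂ + n₃] z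
      + (1 / 12 : ℂ) * Te [n₁ + n₂, n₃] z
      + (1 / 12 : ℂ) * Te [n₃, n₁ + n₂] z
      + (1 / 12 : ℂ) * Te [n₂ + n₃, n₁] z
      - (1 / 6 : ℂ) * Te [n₂, n₁ + n₃] z := by
  have q1 : ∀ a b : ℕ, 2 ≤ a → 2 ≤ b →
      Te [a] z * Te [b] z = Te [a, b] z + Te [b, a] z + Te [a + b] z := by
    intro a b ha hb
    rw [Te1, Te1, Te1, Te2, Te2, L1 _ _ (ff_sum z a ha) (ff_sum z b hb), ff_add z hz]
  have q2 : ∀ a b c : ℕ, 2 ≤ a → 2 ≤ b → 2 ≤ c →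
      Te [a] z * Te [b, c] z = Te [a, b, c] z + Te [b, a, c] z + Te [b, c, a] z
        + Te [a + b, c] z + Te [b, a + c] z := by
    intro a b c ha hb hc
    rw [Te1, Te3, Te3, Te3, Te2, Te2, Te2,
      L2 _ _ _ (ff_sum z a ha) (ff_sum z b hb) (ff_sum z c hc), ff_add z hz, ff_add z hz]
  rw [Tan3, Ten3, Ten2, Ten2, Ten1]
  have p1 := q1 n₂ n₃ h₂ h₃
  have p2 := q1 (n₁ + n₂) n₃ (by omega) h₃
  have p3 := q1 n₁ (n₂ + n₃) h₁ (by omega)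
  have r1 := q2 n₁ n₂ n₃ h₁ h₂ h₃
  have r2 := q2 n₁ n₃ n₂ h₁ h₃ h₂
  have r3 := q2 n₃ n₁ n₂ h₃ h₁ h₂
  rw [add_comm n₃ n₁, add_comm n₃ n₂] at r3
  rw [← add_assoc] at p3
  linear_combination (1/3) * Te [n₁] z * p1 + (1/3-1/2) * r1 + (1/3) * r2 - (1/2) * r3
    - (1/4) * p2 + (1/3-1/4) * p3
end
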